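/- Fix an integer e ≥ 2 and κ = (κ₁, κ₂) ∈ (ℤ/eℤ)². Suppose λ and μ are bipartitions, i ∈ ℤ/eℤ and u ≥ 0 are such that [μ] ⊆ [λ] and [λ] ∖ [μ] consists of exactly u nodes, each of which is a removable i-node of λ. Then wt(μ) = wt(λ) + u·(δ_i(λ) − u). -/

import Mathlib

namespace Wt3

/-- `f : ℕ → ℕ` (0-indexed: `f r` is the `(r+1)`-th part `λ_{r+1}`) is a partition if it is
weakly decreasing with finitely many nonzero terms. -/
def IsPartition (f : ℕ → ℕ) : Prop :=
  (∀ r, f (r + 1) ≤ f r) ∧ ∃ N, ∀ r, N ≤ r → f r = 0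

/-- A bipartition: an ordered pair of partitions, given as `lam : Fin 2 → ℕ → ℕ`. -/
def IsBipartition (lam : Fin 2 → ℕ → ℕ) : Prop := ∀ a, IsPartition (lam a)

/-- Nodes `(r, c, a)` with 0-indexed row `r`, column `c`, and component `a : Fin 2`. -/
abbrev Node := ℕ × ℕ × Fin 2

/-- The Young diagram of a bipartition: `(r,c,a)` is a node iff `c < λ⁽ᵃ⁾_r` (0-indexed,
corresponding to `c+1 ≤ λ⁽ᵃ⁾_{r+1}` in 1-indexed terms). -/
def Diagram (lam : Fin 2 → ℕ → ℕ) : Set Node := {x | x.2.1 < lam x.2.2 x.1}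

/-- A node of `[λ]` is removable if deleting it leaves the Young diagram of a bipartition. -/
def IsRemovable (lam : Fin 2 → ℕ → ℕ) (x : Node) : Prop :=
  x ∈ Diagram lam ∧ ∃ mu, IsBipartition mu ∧ Diagram mu = Diagram lam \ {x}

/-- A node not in `[λ]` is addable if adding it gives the Young diagram of a bipartition. -/
def IsAddable (lam : Fin 2 → ℕ → ℕ) (x : Node) : Prop :=
  x ∉ Diagram lam ∧ ∃ mu, IsBipartition mu ∧ Diagram mu = Diagram lam ∪ {x}

/-- The residue `c − r + κ_a ∈ ℤ/eℤ` of a node `(r,c,a)` (0-indexing leaves this unchanged). -/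
def res (e : ℕ) (κ : Fin 2 → ZMod e) (x : Node) : ZMod e :=
  (x.2.1 : ZMod e) - (x.1 : ZMod e) + κ x.2.2

/-- `c_i(λ)`: the number of `i`-nodes of `λ`. -/
noncomputable def cnt (e : ℕ) (κ : Fin 2 → ZMod e) (lam : Fin 2 → ℕ → ℕ) (i : ZMod e) : ℕ :=
  Set.ncard {x : Node | x ∈ Diagram lam ∧ res e κ x = i}

/-- The number of removable `i`-nodes of `λ`. -/
noncomputable def remCount (e : ℕ) (κ : Fin 2 → ZMod e) (lam : Fin 2 → ℕ → ℕ) (i : ZMod e) : ℕ :=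
  Set.ncard {x : Node | IsRemovable lam x ∧ res e κ x = i}

/-- The number of addable `i`-nodes of `λ`. -/
noncomputable def addCount (e : ℕ) (κ : Fin 2 → ZMod e) (lam : Fin 2 → ℕ → ℕ) (i : ZMod e) : ℕ :=
  Set.ncard {x : Node | IsAddable lam x ∧ res e κ x = i}

/-- `δ_i(λ)`: number of removable `i`-nodes minus number of addable `i`-nodes. -/
noncomputable def delta (e : ℕ) (κ : Fin 2 → ZMod e) (lam : Fin 2 → ℕ → ℕ) (i : ZMod e) : ℤ :=
  (remCount e κ lam i : ℤ) - (addCount e κ lam i : ℤ)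

/-- The weight `wt(λ) = c_{κ₁}(λ) + c_{κ₂}(λ) − ½ Σ_{i ∈ ℤ/eℤ} (c_i(λ) − c_{i+1}(λ))²`. -/
noncomputable def wt (e : ℕ) (κ : Fin 2 → ZMod e) (lam : Fin 2 → ℕ → ℕ) : ℚ :=
  (cnt e κ lam (κ 0) : ℚ) + (cnt e κ lam (κ 1) : ℚ) -
    (1 / 2) * ∑ j ∈ Finset.range e,
      ((cnt e κ lam (j : ZMod e) : ℚ) - (cnt e κ lam ((j : ZMod e) + 1) : ℚ)) ^ 2

/-- The rim of `λ`: nodes `(r,c,a) ∈ [λ]` with `(r+1,c+1,a) ∉ [λ]`. -/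
def Rim (lam : Fin 2 → ℕ → ℕ) : Set Node :=
  {x | x ∈ Diagram lam ∧ (x.1 + 1, x.2.1 + 1, x.2.2) ∉ Diagram lam}

/-- One step along a strip: `y` is one step to the right of, or one step above, `x`
(in the same component). -/
def Step (x y : Node) : Prop :=
  y.2.2 = x.2.2 ∧ ((y.1 = x.1 ∧ y.2.1 = x.2.1 + 1) ∨ (x.1 = y.1 + 1 ∧ y.2.1 = x.2.1))

/-- A rim hook of `λ`: a nonempty subset of the rim, contained in a single component,
forming a connected strip, whose removal leaves the Young diagram of a bipartition. -/
def IsRimHook (lam : Fin 2 → ℕ → ℕ) (H : Finset Node) : Prop :=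
  H.Nonempty ∧ ↑H ⊆ Rim lam ∧ (∀ x ∈ H, ∀ y ∈ H, x.2.2 = y.2.2) ∧
    (∃ l : List Node, l.Chain' Step ∧ ∀ x : Node, x ∈ l ↔ x ∈ H) ∧
    ∃ mu, IsBipartition mu ∧ Diagram mu = Diagram lam \ ↑H

/-- A bicore: a bipartition with no rim `e`-hooks. -/
def IsBicore (e : ℕ) (lam : Fin 2 → ℕ → ℕ) : Prop :=
  ¬ ∃ H : Finset Node, IsRimHook lam H ∧ H.card = e

/-- The beta-set `{λ_r + k − r : 1 ≤ r ≤ k}` of a partition with charge `k` (0-indexed form). -/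
def betaSet (f : ℕ → ℕ) (k : ℕ) : Finset ℕ :=
  (Finset.range k).image fun r => f r + (k - (r + 1))

/-- The number of nonzero parts of a partition. -/
noncomputable def len (f : ℕ → ℕ) : ℕ := Set.ncard {r : ℕ | f r ≠ 0}

/-- `(k₁,k₂)` is a bicharge for `κ` relative to `λ`. -/
def IsBicharge (e : ℕ) (κ : Fin 2 → ZMod e) (lam : Fin 2 → ℕ → ℕ) (k₁ k₂ : ℕ) : Prop :=
  (k₁ : ZMod e) = κ 0 ∧ (k₂ : ZMod e) = κ 1 ∧ len (lam 0) ≤ k₁ ∧ len (lam 1) ≤ k₂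

/-- `γ_x(λ)`: beads of residue `x` in the first beta-set minus those in the second. -/
def gamma (e : ℕ) (lam : Fin 2 → ℕ → ℕ) (k₁ k₂ : ℕ) (x : ZMod e) : ℤ :=
  (((betaSet (lam 0) k₁).filter fun b : ℕ => (b : ZMod e) = x).card : ℤ) -
    (((betaSet (lam 1) k₂).filter fun b : ℕ => (b : ZMod e) = x).card : ℤ)

/-- `x` is above (higher than) `y`. -/
def Above (x y : Node) : Prop := x.2.2 < y.2.2 ∨ (x.2.2 = y.2.2 ∧ x.1 < y.1)

/-- A normal `i`-node: a removable `i`-node `x` such that for every addable `i`-node `y`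
below `x`, the removable `i`-nodes strictly between `x` and `y` outnumber the addable ones
(equivalently, the `−` sign of `x` survives in the reduced `i`-signature). -/
def IsNormal (e : ℕ) (κ : Fin 2 → ZMod e) (lam : Fin 2 → ℕ → ℕ) (i : ZMod e) (x : Node) :
    Prop :=
  IsRemovable lam x ∧ res e κ x = i ∧
    ∀ y : Node, IsAddable lam y → res e κ y = i → Above x y →
      Set.ncard {z : Node | IsAddable lam z ∧ res e κ z = i ∧ Above x z ∧ Above z y} <
        Set.ncard {z : Node | IsRemovable lam z ∧ res e κ z = i ∧ Above x z ∧ Above z y}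

/-- The good `i`-node: the highest normal `i`-node. -/
def IsGood (e : ℕ) (κ : Fin 2 → ZMod e) (lam : Fin 2 → ℕ → ℕ) (i : ZMod e) (x : Node) :
    Prop :=
  IsNormal e κ lam i x ∧ ∀ y, IsNormal e κ lam i y → y = x ∨ Above x y

/-- An antinormal `i`-node: a removable `i`-node `x` such that for every addable `i`-node `y`
above `x`, the removable `i`-nodes strictly between `y` and `x` outnumber the addable ones
(equivalently, the `−` sign of `x` survives in the antireduced `i`-signature). -/
def IsAntinormal (e : ℕ) (κ : Fin 2 → ZMod e) (lam : Fin 2 → ℕ → ℕ) (i : ZMod e) (x : Node) :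
    Prop :=
  IsRemovable lam x ∧ res e κ x = i ∧
    ∀ y : Node, IsAddable lam y → res e κ y = i → Above y x →
      Set.ncard {z : Node | IsAddable lam z ∧ res e κ z = i ∧ Above y z ∧ Above z x} <
        Set.ncard {z : Node | IsRemovable lam z ∧ res e κ z = i ∧ Above y z ∧ Above z x}

/-- The antigood `i`-node: the lowest antinormal `i`-node. -/
def IsAntigood (e : ℕ) (κ : Fin 2 → ZMod e) (lam : Fin 2 → ℕ → ℕ) (i : ZMod e) (x : Node) :
    Prop :=
  IsAntinormal e κ lam i x ∧ ∀ y, IsAntinormal e κ lam i y → y = x ∨ Above y x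

/-- `μ →ᵢ λ`: `μ` is obtained from `λ` by removing the good `i`-node. -/
def RemGoodAt (e : ℕ) (κ : Fin 2 → ZMod e) (i : ZMod e) (mu lam : Fin 2 → ℕ → ℕ) : Prop :=
  ∃ x, IsGood e κ lam i x ∧ Diagram mu = Diagram lam \ {x}

/-- `μ ⇒ᵢ λ`: `μ` is obtained from `λ` by removing the antigood `i`-node. -/
def RemAntigoodAt (e : ℕ) (κ : Fin 2 → ZMod e) (i : ZMod e) (mu lam : Fin 2 → ℕ → ℕ) : Prop :=
  ∃ x, IsAntigood e κ lam i x ∧ Diagram mu = Diagram lam \ {x}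

/-- `μ → λ`: `μ` is obtained from the bipartition `λ` by removing a good node. -/
def RemGood (e : ℕ) (κ : Fin 2 → ZMod e) (mu lam : Fin 2 → ℕ → ℕ) : Prop :=
  IsBipartition mu ∧ IsBipartition lam ∧ ∃ i, RemGoodAt e κ i mu lam

/-- A bipartition is restricted if it lies in the class of the empty bipartition under the
equivalence relation generated by `→`. -/
def IsRestricted (e : ℕ) (κ : Fin 2 → ZMod e) (lam : Fin 2 → ℕ → ℕ) : Prop :=
  Relation.EqvGen (RemGood e κ) lam (fun _ _ => 0)

/-- A partition is `e`-restricted if `λ_r − λ_{r+1} < e` for all `r`. -/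
def IsERestricted (e : ℕ) (f : ℕ → ℕ) : Prop := ∀ r, f r < f (r + 1) + e

/-- The conjugate partition: `λ′_r = #{c : λ_c ≥ r}` (0-indexed form). -/
noncomputable def conjP (f : ℕ → ℕ) : ℕ → ℕ := fun r => Set.ncard {c : ℕ | r + 1 ≤ f c}

/-- The conjugate bipartition `λ′ = ((λ⁽²⁾)′ | (λ⁽¹⁾)′)`. -/
noncomputable def conjB (lam : Fin 2 → ℕ → ℕ) : Fin 2 → ℕ → ℕ := fun a => conjP (lam (1 - a))

/-- `|λ|` for a partition. -/
noncomputable def psize (f : ℕ → ℕ) : ℕ := Set.ncard {p : ℕ × ℕ | p.2 < f p.1}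

/-- `|λ|` for a bipartition. -/
noncomputable def bsize (lam : Fin 2 → ℕ → ℕ) : ℕ := psize (lam 0) + psize (lam 1)

/-- `λ_1 + ⋯ + λ_r`. -/
def psum (f : ℕ → ℕ) (r : ℕ) : ℕ := ∑ j ∈ Finset.range r, f j

/-- The dominance order on bipartitions: `λ ⊵ μ`. -/
def Dominates (lam mu : Fin 2 → ℕ → ℕ) : Prop :=
  ∀ r : ℕ, psum (mu 0) r ≤ psum (lam 0) r ∧
    psize (mu 0) + psum (mu 1) r ≤ psize (lam 0) + psum (lam 1) r

/-! Single-partition versions (for statement 11). -/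

abbrev Node1 := ℕ × ℕ

def Diagram1 (f : ℕ → ℕ) : Set Node1 := {x | x.2 < f x.1}

def IsRemovable1 (f : ℕ → ℕ) (x : Node1) : Prop :=
  x ∈ Diagram1 f ∧ ∃ g, IsPartition g ∧ Diagram1 g = Diagram1 f \ {x}

def IsAddable1 (f : ℕ → ℕ) (x : Node1) : Prop :=
  x ∉ Diagram1 f ∧ ∃ g, IsPartition g ∧ Diagram1 g = Diagram1 f ∪ {x}

def res1 (e : ℕ) (k : ZMod e) (x : Node1) : ZMod e := (x.2 : ZMod e) - (x.1 : ZMod e) + k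

def Rim1 (f : ℕ → ℕ) : Set Node1 := {x | x ∈ Diagram1 f ∧ (x.1 + 1, x.2 + 1) ∉ Diagram1 f}

def Step1 (x y : Node1) : Prop :=
  (y.1 = x.1 ∧ y.2 = x.2 + 1) ∨ (x.1 = y.1 + 1 ∧ y.2 = x.2)

def IsRimHook1 (f : ℕ → ℕ) (H : Finset Node1) : Prop :=
  H.Nonempty ∧ ↑H ⊆ Rim1 f ∧
    (∃ l : List Node1, l.Chain' Step1 ∧ ∀ x : Node1, x ∈ l ↔ x ∈ H) ∧
    ∃ g, IsPartition g ∧ Diagram1 g = Diagram1 f \ ↑H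

/-- An `e`-core: a partition with no rim `e`-hooks. -/
def IsECore (e : ℕ) (f : ℕ → ℕ) : Prop := ¬ ∃ H : Finset Node1, IsRimHook1 f H ∧ H.card = e

/-! The statement. -/

lemma IsPartition.antitone {f : ℕ → ℕ} (hf : IsPartition f) : Antitone f :=
  antitone_nat_of_succ_le hf.1

lemma mem_Diagram {lam : Fin 2 → ℕ → ℕ} {r c : ℕ} {a : Fin 2} :
    ((r, c, a) : Node) ∈ Diagram lam ↔ c < lam a r := Iff.rfl

lemma IsBipartition.exists_bound {lam : Fin 2 → ℕ → ℕ} (hlam : IsBipartition lam) :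
    ∃ N, ∀ a r, N ≤ r → lam a r = 0 := by
  choose N hN using fun a => (hlam a).2
  refine ⟨N 0 + N 1, fun a r hr => hN a r ?_⟩
  fin_cases a <;> simp <;> omega

lemma isBipartition_update {lam : Fin 2 → ℕ → ℕ} (hlam : IsBipartition lam) {a : Fin 2} {r c : ℕ}
    (hbelow : lam a (r + 1) ≤ c) (habove : ∀ s, s + 1 = r → c ≤ lam a s) :
    IsBipartition (Function.update lam a (Function.update (lam a) r c)) := by
  intro b
  by_cases hb : b = a
  · subst hb
    rw [Function.update_self]
    obtain ⟨h1, N, hN⟩ := hlam b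
    refine ⟨fun s => ?_, N + r + 1, fun s hs => ?_⟩
    · have := h1 s
      by_cases hs : s = r
      · subst hs
        simpa using hbelow
      · by_cases hs' : s + 1 = r
        · simpa [hs', Function.update_of_ne hs] using habove s hs'
        · simpa [Function.update_of_ne hs, Function.update_of_ne hs'] using this
    · rw [Function.update_of_ne (by omega)]
      exact hN s (by omega)
  · rw [Function.update_of_ne hb]
    exact hlam b

lemma mem_Diagram_update {lam : Fin 2 → ℕ → ℕ} {a b : Fin 2} {r s c d : ℕ} :
    ((s, d, b) : Node) ∈ Diagram (Function.update lam a (Function.update (lam a) r c)) ↔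
      if b = a ∧ s = r then d < c else d < lam b s := by
  rw [mem_Diagram]
  by_cases hb : b = a
  · subst hb
    by_cases hs : s = r <;> simp [hs]
  · simp [hb]

lemma isRemovable_iff {lam : Fin 2 → ℕ → ℕ} (hlam : IsBipartition lam) {r c : ℕ} {a : Fin 2} :
    IsRemovable lam (r, c, a) ↔ lam a r = c + 1 ∧ lam a (r + 1) < lam a r := by
  constructor
  · rintro ⟨hx, mu, hmu, h⟩
    have key : ∀ s d, d < mu a s ↔ d < lam a s ∧ ¬(s = r ∧ d = c) := fun s d => by
      simpa [mem_Diagram] using Set.ext_iff.mp h (s, d, a)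
    have hx' : c < lam a r := hx
    have h1 := key r c
    have h2 := key r (c + 1)
    have h3 := key (r + 1) c
    have h4 := (hmu a).1 r
    simp only [true_and, not_true_eq_false, and_false, iff_false] at h1
    simp only [true_and, Nat.succ_ne_self, not_false_eq_true, and_true] at h2 h3
    omega
  · rintro ⟨h1, h2⟩
    refine ⟨mem_Diagram.mpr (by omega), _,
      isBipartition_update hlam (r := r) (c := c) (a := a) (by omega) fun s hs => ?_, ?_⟩
    · subst hs
      have := (hlam a).1 s
      omega
    · ext ⟨s, d, b⟩
      rw [mem_Diagram_update]
      simp only [Set.mem_sdiff, mem_Diagram, Set.mem_singleton_iff, Prod.mk.injEq]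
      split_ifs with hbs
      · obtain ⟨rfl, rfl⟩ := hbs
        simp only [true_and, and_true]
        omega
      · tauto

lemma isAddable_iff {lam : Fin 2 → ℕ → ℕ} (hlam : IsBipartition lam) {r c : ℕ} {a : Fin 2} :
    IsAddable lam (r, c, a) ↔ lam a r = c ∧ (r = 0 ∨ lam a r < lam a (r - 1)) := by
  constructor
  · rintro ⟨hx, mu, hmu, h⟩
    have key : ∀ s d, d < mu a s ↔ d < lam a s ∨ (s = r ∧ d = c) := fun s d => by
      simpa [mem_Diagram, or_comm] using Set.ext_iff.mp h (s, d, a)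
    have hx' : ¬c < lam a r := hx
    have h1 := key r c
    have h2 := key r (c - 1)
    simp only [true_and, or_true, iff_true] at h1 h2
    have hc : lam a r = c := by omega
    refine ⟨hc, ?_⟩
    rcases r with _ | r
    · exact Or.inl rfl
    · have h3 := key r c
      have h4 := (hmu a).1 r
      simp only [Nat.left_eq_add, one_ne_zero, false_and, or_false] at h3
      simp only [Nat.add_sub_cancel]
      omega
  · rintro ⟨h1, h2⟩
    refine ⟨fun h => by rw [mem_Diagram] at h; omega, _,
      isBipartition_update hlam (r := r) (c := c + 1) (a := a) ?_ fun s hs => ?_, ?_⟩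
    · have := (hlam a).1 r
      omega
    · subst hs
      simp only [Nat.add_sub_cancel] at h2
      omega
    · ext ⟨s, d, b⟩
      rw [mem_Diagram_update]
      simp only [Set.mem_union, mem_Diagram, Set.mem_singleton_iff, Prod.mk.injEq]
      split_ifs with hbs
      · obtain ⟨rfl, rfl⟩ := hbs
        simp only [true_and, and_true]
        omega
      · tauto

lemma finite_Diagram {lam : Fin 2 → ℕ → ℕ} (hlam : IsBipartition lam) :
    (Diagram lam).Finite := by
  obtain ⟨N, hN⟩ := hlam.exists_bound
  refine ((Finset.range N ×ˢ Finset.range (lam 0 0 + lam 1 0) ×ˢ Finset.univ).finite_toSet).subset ?_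
  rintro ⟨r, c, a⟩ hx
  rw [mem_Diagram] at hx
  have h1 := (hlam a).antitone (Nat.zero_le r)
  have h2 : lam a 0 ≤ lam 0 0 + lam 1 0 := by fin_cases a <;> simp
  have h3 : r < N := by
    by_contra h
    have := hN a r (by omega)
    omega
  simp only [Finset.coe_product, Set.mem_prod, Finset.mem_coe, Finset.mem_range, Finset.mem_univ,
    and_true]
  omega

section Counting

variable {e : ℕ} (κ : Fin 2 → ZMod e) {lam : Fin 2 → ℕ → ℕ}

lemma cnt_eq_sum {N : ℕ} (hN : ∀ a r, N ≤ r → lam a r = 0) (j : ZMod e) :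
    (cnt e κ lam j : ℤ) = ∑ a, ∑ r ∈ Finset.range N, ∑ c ∈ Finset.range (lam a r),
      if (c : ZMod e) - r + κ a = j then 1 else 0 := by
  have hset : {x : Node | x ∈ Diagram lam ∧ res e κ x = j} =
      (((Finset.univ.sigma fun a : Fin 2 => (Finset.range N).sigma fun r =>
        Finset.range (lam a r)).filter fun t =>
          (t.2.2 : ZMod e) - t.2.1 + κ t.1 = j).image fun t => ((t.2.1, t.2.2, t.1) : Node)) := by
    ext ⟨r, c, a⟩
    simp only [Set.mem_ofPred_eq, mem_Diagram, res, Finset.coe_image, Finset.coe_filter,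
      Finset.mem_sigma, Finset.mem_univ, true_and, Finset.mem_range, Set.mem_image,
      Prod.mk.injEq]
    constructor
    · rintro ⟨h1, h2⟩
      refine ⟨⟨a, r, c⟩, ⟨⟨?_, h1⟩, h2⟩, rfl, rfl, rfl⟩
      by_contra h
      exact absurd h1 (by simp [hN a r (not_lt.mp h)])
    · rintro ⟨⟨a, r, c⟩, ⟨⟨_, h1⟩, h2⟩, rfl, rfl, rfl⟩
      exact ⟨h1, h2⟩
  rw [cnt, hset, Set.ncard_coe_finset, Finset.card_image_of_injective, Finset.card_filter]
  · push_cast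
    simp only [Finset.sum_sigma]
  · rintro ⟨a, r, c⟩ ⟨a', r', c'⟩ h
    simp only [Prod.mk.injEq] at h
    obtain ⟨rfl, rfl, rfl⟩ := h
    rfl

/-- Counting nodes that are determined by their component and row. -/
lemma ncard_eq_sum_rows {S : Set Node} {M : ℕ} (col : Fin 2 → ℕ → ℕ) (p : Fin 2 → ℕ → Prop)
    [∀ a r, Decidable (p a r)]
    (hS : ∀ r c a, ((r, c, a) : Node) ∈ S ↔ r < M ∧ c = col a r ∧ p a r) :
    (S.ncard : ℤ) = ∑ a, ∑ r ∈ Finset.range M, if p a r then 1 else 0 := by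
  have hset : S = (((Finset.univ ×ˢ Finset.range M).filter fun t : Fin 2 × ℕ =>
      p t.1 t.2).image fun t => ((t.2, col t.1 t.2, t.1) : Node)) := by
    ext ⟨r, c, a⟩
    rw [hS]
    simp only [Finset.coe_image, Finset.coe_filter, Finset.mem_product, Finset.mem_univ, true_and,
      Finset.mem_range, Set.mem_image, Set.mem_ofPred_eq, Prod.mk.injEq, Prod.exists]
    constructor
    · rintro ⟨h1, rfl, h2⟩
      exact ⟨a, r, ⟨h1, h2⟩, rfl, rfl, rfl⟩
    · rintro ⟨a, r, ⟨h1, h2⟩, rfl, rfl, rfl⟩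
      exact ⟨h1, rfl, h2⟩
  rw [hset, Set.ncard_coe_finset, Finset.card_image_of_injective, Finset.card_filter]
  · push_cast
    rw [Finset.sum_product]
  · rintro ⟨a, r⟩ ⟨a', r'⟩ h
    simp only [Prod.mk.injEq] at h
    obtain ⟨rfl, -, rfl⟩ := h
    rfl

lemma remCount_eq_sum (hlam : IsBipartition lam) {N : ℕ} (hN : ∀ a r, N ≤ r → lam a r = 0)
    (i : ZMod e) :
    (remCount e κ lam i : ℤ) = ∑ a, ∑ r ∈ Finset.range N,
      if lam a (r + 1) < lam a r ∧ (lam a r : ZMod e) - 1 - r + κ a = i then 1 else 0 := by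
  refine ncard_eq_sum_rows (fun a r => lam a r - 1) _ fun r c a => ?_
  simp only [Set.mem_ofPred_eq, isRemovable_iff hlam, res]
  constructor
  · rintro ⟨⟨h1, h2⟩, h3⟩
    refine ⟨?_, by omega, h2, ?_⟩
    · by_contra h
      have := hN a r (by omega)
      omega
    · rw [h1]
      simpa using h3
  · rintro ⟨-, rfl, h2, h3⟩
    refine ⟨⟨by omega, h2⟩, ?_⟩
    rw [Nat.cast_sub (by omega)]
    simpa using h3

lemma addCount_eq_sum (hlam : IsBipartition lam) {N : ℕ} (hN : ∀ a r, N ≤ r → lam a r = 0)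
    (i : ZMod e) :
    (addCount e κ lam i : ℤ) = ∑ a, ∑ r ∈ Finset.range (N + 1),
      if (r = 0 ∨ lam a r < lam a (r - 1)) ∧ (lam a r : ZMod e) - r + κ a = i then 1 else 0 := by
  refine ncard_eq_sum_rows lam _ fun r c a => ?_
  simp only [Set.mem_ofPred_eq, isAddable_iff hlam, res]
  constructor
  · rintro ⟨⟨rfl, h2⟩, h3⟩
    refine ⟨?_, rfl, h2, h3⟩
    by_contra h
    have := hN a (r - 1) (by omega)
    omega
  · rintro ⟨-, rfl, h2, h3⟩
    exact ⟨⟨rfl, h2⟩, h3⟩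

end Counting

section Telescoping

variable {R : Type*} [CommRing R] (H : R → ℤ)

lemma sum_second_difference (x : R) (n : ℕ) :
    ∑ c ∈ Finset.range n, (2 * H (c + x) - H (c + x + 1) - H (c + x - 1)) =
      H x - H (x - 1) + H (n + x - 1) - H (n + x) := by
  induction n with
  | zero => simp
  | succ n ih =>
    rw [Finset.sum_range_succ, ih]
    have h1 : ((n + 1 : ℕ) : R) + x - 1 = n + x := by push_cast; ring
    have h2 : ((n + 1 : ℕ) : R) + x = n + x + 1 := by push_cast; ring
    rw [h1, h2]
    ring

lemma sum_rows_second_difference {f : ℕ → ℕ} (hf : ∀ r, f (r + 1) ≤ f r) (k : R) (N : ℕ) :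
    ∑ r ∈ Finset.range N, ∑ c ∈ Finset.range (f r),
        (2 * H (c - r + k) - H (c - r + k + 1) - H (c - r + k - 1)) =
      ∑ r ∈ Finset.range N, (if f (r + 1) < f r then H (f r - 1 - r + k) else 0)
      - ∑ r ∈ Finset.range N, (if f (r + 1) < f r then H (f (r + 1) - (r + 1 : ℕ) + k) else 0)
      - H (f 0 + k) + H k + H (f N - N + k) - H (k - N) := by
  induction N with
  | zero => simp
  | succ N ih =>
    rw [Finset.sum_range_succ, ih, Finset.sum_range_succ, Finset.sum_range_succ]
    have hrow := sum_second_difference H (k - (N : R)) (f N)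
    have e1 : ∀ c : R, c - N + k = c + (k - N) := fun c => by ring
    have e2 : (f N : R) - 1 + (k - N) = f N + (k - N) - 1 := by ring
    have e3 : k - ((N + 1 : ℕ) : R) = k - N - 1 := by push_cast; ring
    simp only [e1]
    rw [hrow, e2, e3]
    split_ifs with h
    · ring
    · have h4 : f (N + 1) = f N := by have := hf N; omega
      have e4 : (f (N + 1) : R) - ((N + 1 : ℕ) : R) + k = f N + (k - N) - 1 := by
        rw [h4]; push_cast; ring
      rw [e4]
      ring

end Telescoping

/-- The number `δ_i` is determined by the residue content. -/
lemma delta_eq {e : ℕ} (κ : Fin 2 → ZMod e) {lam : Fin 2 → ℕ → ℕ} (hlam : IsBipartition lam)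
    (i : ZMod e) :
    delta e κ lam i = 2 * cnt e κ lam i - cnt e κ lam (i - 1) - cnt e κ lam (i + 1)
      - ∑ a, if κ a = i then 1 else 0 := by
  obtain ⟨N, hN⟩ := hlam.exists_bound
  rw [delta, remCount_eq_sum κ hlam hN, addCount_eq_sum κ hlam hN, cnt_eq_sum κ hN,
    cnt_eq_sum κ hN, cnt_eq_sum κ hN, Finset.mul_sum]
  simp only [← Finset.sum_sub_distrib]
  refine Finset.sum_congr rfl fun a _ => ?_
  have key := sum_rows_second_difference (fun z : ZMod e => if z = i then (1 : ℤ) else 0)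
    (hlam a).1 (κ a) N
  have hk : ((0 : ℕ) : ZMod e) - N + κ a = κ a - N := by push_cast; ring
  simp only [hN a N le_rfl, hk, add_sub_cancel_right, Finset.sum_sub_distrib, ← Finset.mul_sum]
    at key
  rw [Finset.sum_range_succ']
  simp only [ite_and, Nat.succ_ne_zero, false_or, Nat.add_sub_cancel, true_or, if_true,
    Nat.cast_zero, sub_zero, eq_sub_iff_add_eq (c := (1 : ZMod e)),
    ← sub_eq_iff_eq_add (b := (1 : ZMod e))] at key ⊢
  linarith

lemma sum_range_natCast {e : ℕ} [NeZero e] (F : ZMod e → ℚ) :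
    ∑ j ∈ Finset.range e, F (j : ZMod e) = ∑ j, F j := by
  refine Finset.sum_nbij' (fun j => (j : ZMod e)) ZMod.val (by simp) ?_ ?_ (by simp) (by simp)
  · intro j _
    simpa using ZMod.val_lt j
  · intro j hj
    exact ZMod.val_cast_of_lt (by simpa using hj)

/-- The effect of lowering one value on the sum of squared cyclic differences. -/
lemma sum_sq_sub_single {e : ℕ} [NeZero e] (he : 2 ≤ e) (c : ZMod e → ℚ) (i : ZMod e) (u : ℚ) :
    ∑ j, ((c j - if j = i then u else 0) - (c (j + 1) - if j + 1 = i then u else 0)) ^ 2 =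
      ∑ j, (c j - c (j + 1)) ^ 2 - 2 * u * (2 * c i - c (i - 1) - c (i + 1)) + 2 * u ^ 2 := by
  have : Fact (1 < e) := ⟨he⟩
  have hne : i + 1 ≠ i := by simp
  have hterm : ∀ j, ((c j - if j = i then u else 0) - (c (j + 1) - if j + 1 = i then u else 0)) ^ 2
      = (c j - c (j + 1)) ^ 2 + (if j = i then u ^ 2 - 2 * u * (c i - c (i + 1)) else 0)
        + (if j = i - 1 then u ^ 2 + 2 * u * (c (i - 1) - c i) else 0) := by
    intro j
    simp only [eq_sub_iff_add_eq]
    by_cases h1 : j = i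
    · subst h1
      simp only [if_true, hne, if_false]
      ring
    · by_cases h2 : j + 1 = i
      · subst h2
        simp only [h1, if_true, if_false, add_sub_cancel_right]
        ring
      · simp [h1, h2]
  simp only [hterm, Finset.sum_add_distrib, Finset.sum_ite_eq', Finset.mem_univ, if_true]
  ring

lemma cnt_eq_sub {e : ℕ} (κ : Fin 2 → ZMod e) {lam mu : Fin 2 → ℕ → ℕ}
    (hlam : IsBipartition lam) {i : ZMod e} (hsub : Diagram mu ⊆ Diagram lam)
    (hres : ∀ x ∈ Diagram lam \ Diagram mu, res e κ x = i) (j : ZMod e) :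
    (cnt e κ mu j : ℚ) = cnt e κ lam j -
      if j = i then ((Diagram lam \ Diagram mu).ncard : ℚ) else 0 := by
  have hfin := finite_Diagram hlam
  split_ifs with hj
  · subst hj
    have hdisj : Disjoint {x : Node | x ∈ Diagram mu ∧ res e κ x = j}
        (Diagram lam \ Diagram mu) :=
      Set.disjoint_left.mpr fun x hx hx' => hx'.2 hx.1
    have hunion : {x : Node | x ∈ Diagram lam ∧ res e κ x = j} =
        {x : Node | x ∈ Diagram mu ∧ res e κ x = j} ∪ (Diagram lam \ Diagram mu) := by
      ext x
      have h1 := @hsub x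
      have h2 := hres x
      simp only [Set.mem_ofPred_eq, Set.mem_union, Set.mem_sdiff] at h2 ⊢
      tauto
    rw [eq_sub_iff_add_eq, cnt, cnt, hunion, Set.ncard_union_eq hdisj
      ((hfin.subset hsub).subset fun x hx => hx.1) hfin.sdiff]
    push_cast
    rfl
  · have hset : {x : Node | x ∈ Diagram mu ∧ res e κ x = j} =
        {x : Node | x ∈ Diagram lam ∧ res e κ x = j} := by
      ext x
      have h1 := @hsub x
      have h2 := hres x
      simp only [Set.mem_ofPred_eq, Set.mem_sdiff] at h2 ⊢
      constructor
      · tauto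
      · rintro ⟨h3, h4⟩
        refine ⟨by_contra fun h => hj ?_, h4⟩
        rw [← h4, h2 ⟨h3, h⟩]
    rw [cnt, cnt, hset, sub_zero]

theorem stmt6 (e : ℕ) (he : 2 ≤ e) (κ : Fin 2 → ZMod e) (lam mu : Fin 2 → ℕ → ℕ)
    (hlam : IsBipartition lam) (hmu : IsBipartition mu) (i : ZMod e) (u : ℕ)
    (hsub : Diagram mu ⊆ Diagram lam)
    (hcard : (Diagram lam \ Diagram mu).ncard = u)
    (hrem : ∀ x ∈ Diagram lam \ Diagram mu, IsRemovable lam x ∧ res e κ x = i) :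
    wt e κ mu = wt e κ lam + (u : ℚ) * ((delta e κ lam i : ℚ) - (u : ℚ)) := by
  have : NeZero e := ⟨by omega⟩
  have hcnt := cnt_eq_sub κ hlam hsub fun x hx => (hrem x hx).2
  rw [hcard] at hcnt
  rw [wt, wt, sum_range_natCast fun j => ((cnt e κ mu j : ℚ) - cnt e κ mu (j + 1)) ^ 2,
    sum_range_natCast fun j => ((cnt e κ lam j : ℚ) - cnt e κ lam (j + 1)) ^ 2, delta_eq κ hlam i]
  simp only [hcnt]
  rw [sum_sq_sub_single he (fun j => (cnt e κ lam j : ℚ)) i u, Fin.sum_univ_two]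
  push_cast
  split_ifs <;> ring

end Wt3
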